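/- Let p_n denote the n-th prime number. Then the n-th prime-indexed prime satisfies the asymptotic formula p_{p_n} = n·(log n)² + 3·n·(log n)·(log log n) + O(n·log n) as n → ∞. -/

import Mathlib

open Filter Real Asymptotics

/-- `nthPrime n` is the `n`-th prime with 1-based indexing: `nthPrime 1 = 2`. -/
noncomputable def nthPrime (n : ℕ) : ℕ := Nat.nth Nat.Prime (n - 1)

section Zeta

/-- The `n`-th term of a series for `(s - 1) ζ(s) - 1`, obtained by comparing `∑ m⁻ˢ` with the
integral `∫ x⁻ˢ`. -/
noncomputable def zetaTerm (n : ℕ) (s : ℂ) : ℂ :=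
  (s - 1) * ((n + 1 : ℝ) : ℂ) ^ (-s)
    + (((n + 2 : ℝ) : ℂ) ^ (1 - s) - ((n + 1 : ℝ) : ℂ) ^ (1 - s))

/-- The function `(s - 1) ζ(s)`, extended analytically across `s = 1`. -/
noncomputable def zetaMul (s : ℂ) : ℂ := 1 + ∑' n, zetaTerm n s

lemma hasDerivAt_ofReal_cpow_of_pos {x : ℝ} (hx : 0 < x) (r : ℂ) :
    HasDerivAt (fun y : ℝ ↦ (y : ℂ) ^ r) (r * (x : ℂ) ^ (r - 1)) x := by
  have h := (hasDerivAt_id (x : ℂ)).cpow_const (c := r) (Or.inl (by simpa using hx))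
  simpa using h.comp_ofReal

lemma norm_cpow_neg_sub_le_mul {s : ℂ} (hs : 0 ≤ s.re) {m x : ℝ} (hm : 0 < m)
    (hx : x ∈ Set.Icc m (m + 1)) :
    ‖(x : ℂ) ^ (-s) - (m : ℂ) ^ (-s)‖ ≤ ‖s‖ * m ^ (-s.re - 1) := by
  have := norm_image_sub_le_of_norm_deriv_le_segment' (f := fun y : ℝ ↦ (y : ℂ) ^ (-s))
    (f' := fun y ↦ -s * (y : ℂ) ^ (-s - 1)) (a := m) (b := m + 1) (C := ‖s‖ * m ^ (-s.re - 1))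
    (fun y hy ↦ (hasDerivAt_ofReal_cpow_of_pos (hm.trans_le hy.1) _).hasDerivWithinAt)
    (fun y hy ↦ by
      rw [norm_mul, norm_neg, Complex.norm_cpow_eq_rpow_re_of_pos (hm.trans_le hy.1)]
      simp only [Complex.sub_re, Complex.neg_re, Complex.one_re]
      exact mul_le_mul_of_nonneg_left
        (Real.rpow_le_rpow_of_nonpos hm hy.1 (by linarith)) (norm_nonneg _)) x hx
  refine this.trans (mul_le_of_le_one_right (by positivity) (by linarith [hx.2]))

lemma norm_cpow_neg_sub_le_two {s : ℂ} (hs : 0 ≤ s.re) {m x : ℝ} (hm : 0 < m)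
    (hx : x ∈ Set.Icc m (m + 1)) :
    ‖(x : ℂ) ^ (-s) - (m : ℂ) ^ (-s)‖ ≤ 2 * m ^ (-s.re) := by
  refine (norm_sub_le _ _).trans ?_
  rw [Complex.norm_cpow_eq_rpow_re_of_pos (hm.trans_le hx.1),
    Complex.norm_cpow_eq_rpow_re_of_pos hm, Complex.neg_re]
  linarith [Real.rpow_le_rpow_of_nonpos hm hx.1 (show -s.re ≤ 0 by linarith)]

lemma norm_cpow_neg_sub_le {s : ℂ} (hs : 0 ≤ s.re) {θ : ℝ} (h0 : 0 ≤ θ) (h1 : θ ≤ 1)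
    {m x : ℝ} (hm : 0 < m) (hx : x ∈ Set.Icc m (m + 1)) :
    ‖(x : ℂ) ^ (-s) - (m : ℂ) ^ (-s)‖ ≤ 2 * ‖s‖ ^ θ * m ^ (-s.re - θ) := by
  have e : 2 * ‖s‖ ^ θ * m ^ (-s.re - θ) = 2 * m ^ (-s.re) * (‖s‖ / m) ^ θ := by
    rw [Real.rpow_sub hm, Real.div_rpow (norm_nonneg _) hm.le]; ring
  rw [e]
  rcases le_total m ‖s‖ with h | h
  · refine (norm_cpow_neg_sub_le_two hs hm hx).trans (le_mul_of_one_le_right (by positivity) ?_)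
    exact Real.one_le_rpow ((one_le_div hm).2 h) h0
  · refine (norm_cpow_neg_sub_le_mul hs hm hx).trans ?_
    have h2 : ‖s‖ / m ≤ (‖s‖ / m) ^ θ :=
      Real.self_le_rpow_of_le_one (by positivity) ((div_le_one hm).2 h) h1
    calc ‖s‖ * m ^ (-s.re - 1) = m ^ (-s.re) * (‖s‖ / m) := by
          rw [Real.rpow_sub hm, Real.rpow_one]; ring
      _ ≤ m ^ (-s.re) * (‖s‖ / m) ^ θ := by gcongr
      _ ≤ _ := by
          have : 0 ≤ m ^ (-s.re) * (‖s‖ / m) ^ θ := by positivity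
          linarith

lemma norm_zetaTerm_le {s : ℂ} (hs : 0 ≤ s.re) {θ : ℝ} (h0 : 0 ≤ θ) (h1 : θ ≤ 1) (n : ℕ) :
    ‖zetaTerm n s‖ ≤ 2 * ‖s - 1‖ * ‖s‖ ^ θ * (n + 1 : ℝ) ^ (-s.re - θ) := by
  set m : ℝ := n + 1
  have hm : 0 < m := by positivity
  have hd (y : ℝ) (hy : y ∈ Set.Icc m (m + 1)) :
      HasDerivWithinAt (fun y : ℝ ↦ (s - 1) * (m : ℂ) ^ (-s) * (y : ℂ) + (y : ℂ) ^ (1 - s))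
        ((1 - s) * ((y : ℂ) ^ (-s) - (m : ℂ) ^ (-s))) (Set.Icc m (m + 1)) y := by
    have h1 := hasDerivAt_ofReal_cpow_of_pos (hm.trans_le hy.1) (1 - s)
    have h2 := (Complex.ofRealCLM.hasDerivAt (x := y)).const_mul ((s - 1) * (m : ℂ) ^ (-s))
    refine ((h2.add h1).congr_deriv ?_).hasDerivWithinAt
    rw [show (1 - s - 1 : ℂ) = -s by ring]
    simp
    ring
  have := norm_image_sub_le_of_norm_deriv_le_segment' (a := m) (b := m + 1) hd
    (C := ‖s - 1‖ * (2 * ‖s‖ ^ θ * m ^ (-s.re - θ)))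
    (fun y hy ↦ by
      rw [norm_mul, norm_sub_rev]
      gcongr
      exact norm_cpow_neg_sub_le hs h0 h1 hm ⟨hy.1, hy.2.le⟩) (m + 1) ⟨by linarith, le_rfl⟩
  have e : zetaTerm n s = ((s - 1) * (m : ℂ) ^ (-s) * ((m + 1 : ℝ) : ℂ)
      + ((m + 1 : ℝ) : ℂ) ^ (1 - s)) - ((s - 1) * (m : ℂ) ^ (-s) * (m : ℂ) + (m : ℂ) ^ (1 - s)) := by
    rw [zetaTerm, show (n + 2 : ℝ) = m + 1 by simp only [m]; ring]
    change (s - 1) * (m : ℂ) ^ (-s) + (((m + 1 : ℝ) : ℂ) ^ (1 - s) - (m : ℂ) ^ (1 - s)) = _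
    push_cast
    ring
  rw [e]
  refine this.trans (le_of_eq ?_)
  ring

lemma summable_add_one_rpow_neg {p : ℝ} (hp : 1 < p) :
    Summable fun n : ℕ ↦ (n + 1 : ℝ) ^ (-p) := by
  have := (summable_nat_add_iff 1).2 (Real.summable_nat_rpow (p := -p) |>.2 (by linarith))
  simpa using this

lemma norm_zetaTerm_le_of_re {s : ℂ} {θ : ℝ} (h0 : 0 ≤ θ) (h1 : θ ≤ 1)
    (hs : 1 - θ / 2 ≤ s.re) (n : ℕ) :
    ‖zetaTerm n s‖ ≤ 2 * ‖s - 1‖ * ‖s‖ ^ θ * (n + 1 : ℝ) ^ (-(1 + θ / 2)) := by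
  refine (norm_zetaTerm_le (by linarith) h0 h1 n).trans ?_
  gcongr
  · linarith [(Nat.cast_nonneg n : (0 : ℝ) ≤ n)]
  · linarith

lemma differentiable_zetaTerm (n : ℕ) : Differentiable ℂ (zetaTerm n) := by
  have h (x : ℝ) (hx : x ≠ 0) (f : ℂ → ℂ) (hf : Differentiable ℂ f) :
      Differentiable ℂ fun s ↦ (x : ℂ) ^ f s :=
    fun s ↦ (hf s).const_cpow (Or.inl (by exact_mod_cast hx))
  unfold zetaTerm
  exact ((differentiable_id.sub_const _).mul (h _ (by positivity) _ differentiable_id.neg)).add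
    ((h _ (by positivity) _ (differentiable_id.const_sub 1)).sub
      (h _ (by positivity) _ (differentiable_id.const_sub 1)))

lemma differentiableAt_zetaMul {s : ℂ} (hs : 1 / 2 < s.re) : DifferentiableAt ℂ zetaMul s := by
  set R := ‖s‖ + 1
  have hU : IsOpen ({z : ℂ | 1 / 2 < z.re} ∩ Metric.ball 0 R) :=
    (isOpen_lt continuous_const Complex.continuous_re).inter Metric.isOpen_ball
  have := Complex.differentiableOn_tsum_of_summable_norm (F := zetaTerm)
    (U := {z : ℂ | 1 / 2 < z.re} ∩ Metric.ball 0 R)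
    (u := fun n ↦ 2 * (R + 1) * R ^ (1 : ℝ) * (n + 1 : ℝ) ^ (-(1 + 1 / 2 : ℝ)))
    ((summable_add_one_rpow_neg (by norm_num)).mul_left _)
    (fun n ↦ (differentiable_zetaTerm n).differentiableOn) hU
    (fun n w hw ↦ by
      have hw1 : 1 / 2 < w.re := hw.1
      have hw2 : ‖w‖ < R := by simpa using hw.2
      refine (norm_zetaTerm_le_of_re zero_le_one le_rfl (by linarith) n).trans ?_
      gcongr
      refine (norm_sub_le _ _).trans ?_
      simp only [norm_one]
      gcongr)
  exact (differentiableAt_const _).add (this.differentiableAt (hU.mem_nhds ⟨hs, by simp [R]⟩))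

lemma exists_norm_zetaMul_le {θ : ℝ} (h0 : 0 < θ) (h1 : θ ≤ 1) :
    ∃ C : ℝ, 0 < C ∧ ∀ s : ℂ, 1 - θ / 2 ≤ s.re → s.re ≤ 4 →
      ‖zetaMul s‖ ≤ C * (5 + |s.im|) * (5 + |s.im|) ^ θ := by
  set S := ∑' n : ℕ, (n + 1 : ℝ) ^ (-(1 + θ / 2))
  have hS : Summable fun n : ℕ ↦ (n + 1 : ℝ) ^ (-(1 + θ / 2)) :=
    summable_add_one_rpow_neg (by linarith)
  have hS0 : 0 ≤ S := tsum_nonneg fun n ↦ by positivity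
  refine ⟨1 + 2 * S, by positivity, fun s hs hs' ↦ ?_⟩
  set T := 5 + |s.im|
  have hT : 1 ≤ T := by have := abs_nonneg s.im; simp only [T]; linarith
  have hB : 1 ≤ T ^ θ := Real.one_le_rpow hT h0.le
  have hsT : ‖s‖ ≤ T := (Complex.norm_le_abs_re_add_abs_im s).trans (by
    rw [abs_of_nonneg (by linarith)]; simp only [T]; linarith)
  have hsT1 : ‖s - 1‖ ≤ T := (Complex.norm_le_abs_re_add_abs_im _).trans (by
    have : |s.re - 1| ≤ 3 := abs_le.2 ⟨by linarith, by linarith⟩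
    simp only [Complex.sub_re, Complex.sub_im, Complex.one_re, Complex.one_im, sub_zero, T]
    linarith)
  have hle : ‖∑' n, zetaTerm n s‖ ≤ 2 * ‖s - 1‖ * ‖s‖ ^ θ * S :=
    tsum_of_norm_bounded (hS.hasSum.mul_left _) (norm_zetaTerm_le_of_re h0.le h1 hs)
  calc ‖zetaMul s‖ ≤ 1 + 2 * ‖s - 1‖ * ‖s‖ ^ θ * S := by
        refine (norm_add_le _ _).trans ?_
        simpa using hle
    _ ≤ T * T ^ θ + 2 * T * T ^ θ * S := by
        gcongr
        exact one_le_mul_of_one_le_of_one_le hT hB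
    _ = _ := by ring

lemma zetaMul_eq {s : ℂ} (hs : 1 < s.re) : zetaMul s = (s - 1) * riemannZeta s := by
  have h1 : HasSum (fun n : ℕ ↦ (s - 1) * ((n + 1 : ℝ) : ℂ) ^ (-s)) ((s - 1) * riemannZeta s) := by
    refine HasSum.mul_left _ ?_
    rw [zeta_eq_tsum_one_div_nat_add_one_cpow hs]
    have := ((summable_nat_add_iff 1).2 (Complex.summable_one_div_nat_cpow.2 hs)).hasSum
    simpa [Complex.cpow_neg] using this
  have h2 : HasSum (fun n : ℕ ↦ ((n + 2 : ℝ) : ℂ) ^ (1 - s) - ((n + 1 : ℝ) : ℂ) ^ (1 - s)) (-1) := by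
    have hs2 : Summable (fun n : ℕ ↦ ((n + 2 : ℝ) : ℂ) ^ (1 - s) - ((n + 1 : ℝ) : ℂ) ^ (1 - s)) := by
      have ht : Summable fun n ↦ zetaTerm n s :=
        .of_norm_bounded (g := fun n : ℕ ↦ 2 * ‖s - 1‖ * ‖s‖ ^ (1 : ℝ) *
            (n + 1 : ℝ) ^ (-(1 + 1 / 2 : ℝ)))
          ((summable_add_one_rpow_neg (by norm_num)).mul_left _)
          (norm_zetaTerm_le_of_re zero_le_one le_rfl (by linarith))
      refine (ht.sub h1.summable).congr fun n ↦ ?_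
      simp [zetaTerm]
    rw [hs2.hasSum_iff_tendsto_nat]
    have hlim : Tendsto (fun n : ℕ ↦ ((n + 1 : ℝ) : ℂ) ^ (1 - s)) atTop (nhds 0) := by
      rw [tendsto_zero_iff_norm_tendsto_zero]
      have := (tendsto_rpow_neg_atTop (y := s.re - 1) (by linarith)).comp
        (tendsto_atTop_add_const_right atTop (1 : ℝ) tendsto_natCast_atTop_atTop)
      refine this.congr fun n ↦ ?_
      rw [Complex.norm_cpow_eq_rpow_re_of_pos (by positivity)]
      simp
    have := hlim.sub_const 1
    rw [zero_sub] at this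
    refine this.congr fun n ↦ ?_
    have := Finset.sum_range_sub (fun n : ℕ ↦ ((n + 1 : ℝ) : ℂ) ^ (1 - s)) n
    simp only [Nat.cast_zero, zero_add, Complex.ofReal_one, Complex.one_cpow] at this
    rw [← this]
    refine Finset.sum_congr rfl fun i _ ↦ ?_
    push_cast
    ring_nf
  have := (h1.add h2).tsum_eq
  rw [zetaMul]
  simp only [zetaTerm]
  rw [this]
  ring

lemma zetaMul_one : zetaMul 1 = 1 := by simp [zetaMul, zetaTerm]

lemma zetaMul_eq_of_one_le {s : ℂ} (hs : 1 ≤ s.re) (h1 : s ≠ 1) :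
    zetaMul s = (s - 1) * riemannZeta s := by
  have hlim : Tendsto (fun x : ℝ ↦ s + x) (nhdsWithin 0 (Set.Ioi 0)) (nhds s) := by
    have : Continuous fun x : ℝ ↦ s + x := by fun_prop
    simpa using (this.tendsto 0).mono_left nhdsWithin_le_nhds
  have hz : Tendsto (fun x : ℝ ↦ zetaMul (s + x)) (nhdsWithin 0 (Set.Ioi 0)) (nhds (zetaMul s)) :=
    (differentiableAt_zetaMul (by linarith)).continuousAt.tendsto.comp hlim
  have hr : Tendsto (fun x : ℝ ↦ (s + x - 1) * riemannZeta (s + x)) (nhdsWithin 0 (Set.Ioi 0))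
      (nhds ((s - 1) * riemannZeta s)) :=
    (hlim.sub_const 1).mul ((differentiableAt_riemannZeta h1).continuousAt.tendsto.comp hlim)
  refine tendsto_nhds_unique hz (hr.congr' ?_)
  filter_upwards [self_mem_nhdsWithin] with x hx
  have hx : 0 < x := hx
  exact (zetaMul_eq (by simp; linarith)).symm

lemma zetaMul_ne_zero {s : ℂ} (hs : 1 ≤ s.re) : zetaMul s ≠ 0 := by
  rcases eq_or_ne s 1 with rfl | h
  · simp [zetaMul_one]
  · rw [zetaMul_eq_of_one_le hs h]
    exact mul_ne_zero (sub_ne_zero.2 h) (riemannZeta_ne_zero_of_one_le_re hs)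

lemma norm_riemannZeta_product_ge_one {x : ℝ} (hx : 0 < x) (y : ℝ) :
    1 ≤ ‖riemannZeta (1 + x)‖ ^ 3 * ‖riemannZeta (1 + x + Complex.I * y)‖ ^ 4 *
      ‖riemannZeta (1 + x + 2 * Complex.I * y)‖ := by
  have := DirichletCharacter.norm_LSeries_product_ge_one (1 : DirichletCharacter ℂ 1) hx y
  rw [one_pow] at this
  simp only [DirichletCharacter.LSeries_modOne_eq] at this
  rw [LSeries_one_eq_riemannZeta (by simpa using hx), LSeries_one_eq_riemannZeta (by simpa using hx),
    LSeries_one_eq_riemannZeta (by simpa using hx)] at this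
  simpa [norm_mul, norm_pow] using this

end Zeta

section Bounds

lemma height_le_two_mul {s z : ℂ} {r : ℝ} (hr : r ≤ 1) (h : ‖z - s‖ ≤ r) :
    5 + |z.im| ≤ 2 * (5 + |s.im|) := by
  have h1 : |z.im - s.im| ≤ 1 := by simpa using (Complex.abs_im_le_norm (z - s)).trans (h.trans hr)
  have h2 := abs_sub_abs_le_abs_sub z.im s.im
  linarith [abs_nonneg s.im]

lemma rpow_le_two_mul_rpow {θ T T' : ℝ} (h0 : 0 ≤ θ) (h1 : θ ≤ 1) (hT' : 0 ≤ T') (hT : 0 ≤ T)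
    (h : T' ≤ 2 * T) : T' ^ θ ≤ 2 * T ^ θ := by
  calc T' ^ θ ≤ (2 * T) ^ θ := by gcongr
    _ = 2 ^ θ * T ^ θ := Real.mul_rpow (by norm_num) hT
    _ ≤ 2 ^ (1 : ℝ) * T ^ θ := by gcongr; norm_num
    _ = 2 * T ^ θ := by norm_num

lemma abs_re_sub_le {s z : ℂ} {r : ℝ} (h : ‖z - s‖ ≤ r) : |z.re - s.re| ≤ r := by
  simpa using (Complex.abs_re_le_norm (z - s)).trans h

lemma exists_norm_deriv_zetaMul_le {θ : ℝ} (h0 : 0 < θ) (h1 : θ ≤ 1 / 2) :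
    ∃ C : ℝ, 0 < C ∧ ∀ s : ℂ, 1 - θ / 4 ≤ s.re → s.re ≤ 3 →
      ‖deriv zetaMul s‖ ≤ C * (5 + |s.im|) * (5 + |s.im|) ^ θ := by
  obtain ⟨C, hC, hb⟩ := exists_norm_zetaMul_le h0 (h1.trans (by norm_num))
  refine ⟨C * 4 / (θ / 4), by positivity, fun s hs hs' ↦ ?_⟩
  have hz {z : ℂ} (hz : ‖z - s‖ ≤ θ / 4) : 1 - θ / 2 ≤ z.re ∧ z.re ≤ 4 := by
    have := abs_le.1 (abs_re_sub_le hz)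
    constructor <;> linarith
  have := Complex.norm_deriv_le_of_forall_mem_sphere_norm_le (f := zetaMul) (c := s) (R := θ / 4)
    (C := C * (2 * (5 + |s.im|)) * (2 * (5 + |s.im|) ^ θ)) (by positivity)
    (DifferentiableOn.diffContOnCl_ball (U := Metric.closedBall s (θ / 4)) (fun z hz' ↦
      (differentiableAt_zetaMul (by
        have := (hz (by simpa [dist_eq_norm] using hz')).1
        linarith)).differentiableWithinAt) subset_rfl)
    (fun z hz' ↦ by
      have hz' : ‖z - s‖ ≤ θ / 4 := by simpa [dist_eq_norm] using hz'.le
      have hh := height_le_two_mul (by linarith) hz'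
      refine (hb z (hz hz').1 (hz hz').2).trans ?_
      gcongr
      exact rpow_le_two_mul_rpow h0.le (by linarith) (by positivity) (by positivity) hh)
  refine this.trans (le_of_eq ?_)
  ring

lemma norm_riemannZeta_eq_div {s : ℂ} (hs : 1 < s.re) :
    ‖riemannZeta s‖ = ‖zetaMul s‖ / ‖s - 1‖ := by
  have : s - 1 ≠ 0 := fun h ↦ by
    rw [sub_eq_zero.1 h] at hs
    simp at hs
  rw [zetaMul_eq hs, norm_mul, mul_div_cancel_left₀ _ (norm_ne_zero_iff.2 this)]

lemma exists_le_norm_zetaMul_pow_four {θ : ℝ} (h0 : 0 < θ) (h1 : θ ≤ 1) :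
    ∃ c : ℝ, 0 < c ∧ ∀ s : ℂ, 1 < s.re → s.re ≤ 2 → 1 ≤ |s.im| →
      c * (s.re - 1) ^ 3 * (5 + |s.im|) ^ 4 ≤ ‖zetaMul s‖ ^ 4 * (5 + |s.im|) ^ θ := by
  obtain ⟨C, hC, hb⟩ := exists_norm_zetaMul_le h0 h1
  refine ⟨2 / 6 ^ 5 / ((C * 25) ^ 3 * (4 * C)), by positivity, fun s hs hs' ht ↦ ?_⟩
  set T := 5 + |s.im| with hT
  have hT6 : T / 6 ≤ |s.im| := by linarith
  have hTpos : 0 < T := by positivity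
  have hprod := norm_riemannZeta_product_ge_one (x := s.re - 1) (by linarith) s.im
  have e0 : (1 + ((s.re - 1 : ℝ) : ℂ)) = (s.re : ℂ) := by push_cast; ring
  have e1 : (s.re : ℂ) + Complex.I * s.im = s := by rw [mul_comm]; exact Complex.re_add_im s
  have e2 : (s.re : ℂ) + 2 * Complex.I * s.im = s + Complex.I * s.im := by
    nth_rewrite 3 [← e1]; ring
  rw [e0, e1, e2, norm_riemannZeta_eq_div (by simpa using hs), norm_riemannZeta_eq_div hs,
    norm_riemannZeta_eq_div (by simpa using hs)] at hprod
  have n0 : ‖(s.re : ℂ) - 1‖ = s.re - 1 := by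
    rw [← e0, add_sub_cancel_left, Complex.norm_real, Real.norm_of_nonneg (by linarith)]
  have n1 : |s.im| ≤ ‖s - 1‖ := by simpa using Complex.abs_im_le_norm (s - 1)
  have n2 : 2 * |s.im| ≤ ‖s + Complex.I * s.im - 1‖ := by
    have := Complex.abs_im_le_norm (s + Complex.I * s.im - 1)
    have e : (s + Complex.I * s.im - 1).im = 2 * s.im := by simp; ring
    rwa [e, abs_mul, abs_two] at this
  have z0 : ‖zetaMul (s.re : ℂ)‖ ≤ C * 25 := by
    have := hb (s.re : ℂ) (by simp; linarith) (by simp; linarith)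
    simp only [Complex.ofReal_im, abs_zero, add_zero] at this
    have h5 : (5 : ℝ) ^ θ ≤ 5 ^ (1 : ℝ) := by gcongr; norm_num
    rw [Real.rpow_one] at h5
    nlinarith
  have z2 : ‖zetaMul (s + Complex.I * s.im)‖ ≤ 4 * C * T * T ^ θ := by
    have := hb (s + Complex.I * s.im) (by simp; linarith) (by simp; linarith)
    have e : (s + Complex.I * s.im).im = 2 * s.im := by simp; ring
    have hle : 5 + |(s + Complex.I * s.im).im| ≤ 2 * T := by
      rw [e, abs_mul, abs_two]; linarith
    refine this.trans ?_
    have := rpow_le_two_mul_rpow h0.le h1 (by positivity) hTpos.le hle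
    calc _ ≤ C * (2 * T) * (2 * T ^ θ) := by gcongr
      _ = _ := by ring
  rw [n0] at hprod
  have ha : 0 < s.re - 1 := by linarith
  have key : 1 ≤ (C * 25 / (s.re - 1)) ^ 3 * (‖zetaMul s‖ / (T / 6)) ^ 4 *
      (4 * C * T * T ^ θ / (2 * (T / 6))) := by
    refine hprod.trans ?_
    gcongr
    · exact hT6.trans n1
    · linarith
  have hne : (0 : ℝ) < T ^ θ := by positivity
  have e : (C * 25 / (s.re - 1)) ^ 3 * (‖zetaMul s‖ / (T / 6)) ^ 4 *
      (4 * C * T * T ^ θ / (2 * (T / 6))) = (‖zetaMul s‖ ^ 4 * T ^ θ) /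
        (2 / 6 ^ 5 / ((C * 25) ^ 3 * (4 * C)) * (s.re - 1) ^ 3 * T ^ 4) := by
    field_simp
  rw [e, one_le_div (by positivity)] at key
  exact key

lemma exists_le_norm_zetaMul {θ : ℝ} (h0 : 0 < θ) (h1 : θ ≤ 1 / 2) :
    ∃ c : ℝ, 0 < c ∧ ∀ s : ℂ, 1 ≤ s.re → s.re ≤ 2 →
      c * (5 + |s.im|) / ((5 + |s.im|) ^ θ) ^ 4 ≤ ‖zetaMul s‖ := by
  obtain ⟨c₁, hc₁, hlow⟩ := exists_le_norm_zetaMul_pow_four h0 (h1.trans (by norm_num))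
  obtain ⟨C, hC, hder⟩ := exists_norm_deriv_zetaMul_le h0 h1
  set κ := min 1 (c₁ / (16 * C ^ 4))
  have hκ : 0 < κ := lt_min one_pos (by positivity)
  have hκ1 : κ ≤ 1 := min_le_left _ _
  have hκ2 : κ * (16 * C ^ 4) ≤ c₁ := by
    rw [← le_div_iff₀ (by positivity)]; exact min_le_right _ _
  have hlarge (s : ℂ) (hs : 1 ≤ s.re) (hs' : s.re ≤ 2) (ht : 1 ≤ |s.im|) :
      C * κ * (5 + |s.im|) / ((5 + |s.im|) ^ θ) ^ 4 ≤ ‖zetaMul s‖ := by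
    have hbig (z : ℂ) (hz : 1 + κ / ((5 + |z.im|) ^ θ) ^ 5 ≤ z.re) (hz' : z.re ≤ 2)
        (htz : 1 ≤ |z.im|) :
        2 * (C * κ * (5 + |z.im|) / ((5 + |z.im|) ^ θ) ^ 4) ≤ ‖zetaMul z‖ := by
      set T := 5 + |z.im|
      set B := T ^ θ
      have hT : 0 < T := by positivity
      have hB : 0 < B := by positivity
      have := hlow z (lt_of_lt_of_le (by simp; positivity) hz) hz' htz
      refine le_of_pow_le_pow_left₀ (n := 4) (by norm_num) (norm_nonneg _) ?_
      have h3 : c₁ * (κ / B ^ 5) ^ 3 * T ^ 4 ≤ ‖zetaMul z‖ ^ 4 * B := by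
        refine le_trans ?_ this
        gcongr
        linarith
      have h4 : κ * (16 * C ^ 4) * (κ / B ^ 5) ^ 3 * T ^ 4 ≤ ‖zetaMul z‖ ^ 4 * B := by
        refine le_trans ?_ h3
        gcongr
      rw [← mul_le_mul_iff_left₀ hB]
      refine le_trans (le_of_eq ?_) h4
      field_simp
      norm_num
    rcases le_total (1 + κ / ((5 + |s.im|) ^ θ) ^ 5) s.re with h | h
    · have := hbig s h hs' ht
      have hp : 0 ≤ C * κ * (5 + |s.im|) / ((5 + |s.im|) ^ θ) ^ 4 := by positivity
      linarith
    · set T := 5 + |s.im| with hT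
      set B := T ^ θ with hBdef
      have hTpos : 1 ≤ T := by have := abs_nonneg s.im; linarith
      have hB : 1 ≤ B := Real.one_le_rpow hTpos h0.le
      have hκB : κ / B ^ 5 ≤ 1 := (div_le_one (by positivity)).2 (hκ1.trans (one_le_pow₀ hB))
      set s₀ : ℂ := ⟨1 + κ / B ^ 5, s.im⟩ with hs₀
      have h2 := hbig s₀ (by simp [hs₀, hBdef, hT]) (by simp [hs₀]; linarith) (by simpa [hs₀] using ht)
      have hdist : ‖s - s₀‖ ≤ κ / B ^ 5 := by
        have : s - s₀ = ((s.re - (1 + κ / B ^ 5) : ℝ) : ℂ) := by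
          apply Complex.ext
          · rw [Complex.ofReal_re, Complex.sub_re]
          · rw [Complex.ofReal_im, Complex.sub_im, sub_self]
        rw [this, Complex.norm_real, Real.norm_eq_abs, abs_le]
        constructor <;> linarith
      have hsub : ‖zetaMul s - zetaMul s₀‖ ≤ C * T * B * ‖s - s₀‖ := by
        refine Convex.norm_image_sub_le_of_norm_deriv_le (𝕜 := ℂ)
          (s := {z : ℂ | 1 ≤ z.re} ∩ {z : ℂ | z.re ≤ 2} ∩ {z : ℂ | z.im = s.im})
          (fun z hz ↦ differentiableAt_zetaMul ?_) (fun z hz ↦ ?_) ?_ ?_ ?_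
        · have : 1 ≤ z.re := hz.1.1
          linarith
        · have hz1 : 1 ≤ z.re := hz.1.1
          have hz2 : z.re ≤ 2 := hz.1.2
          have hz3 : z.im = s.im := hz.2
          have := hder z (by linarith) (by linarith)
          rwa [hz3] at this
        · exact ((convex_halfSpace_re_ge 1).inter (convex_halfSpace_re_le 2)).inter
            (convex_hyperplane Complex.imLm.isLinear _)
        · refine ⟨⟨?_, ?_⟩, rfl⟩
          · change 1 ≤ 1 + κ / B ^ 5
            have : 0 ≤ κ / B ^ 5 := by positivity
            linarith
          · change 1 + κ / B ^ 5 ≤ 2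
            linarith
        · exact ⟨⟨hs, hs'⟩, rfl⟩
      have h5 : C * T * B * ‖s - s₀‖ ≤ C * κ * T / B ^ 4 := by
        calc C * T * B * ‖s - s₀‖ ≤ C * T * B * (κ / B ^ 5) := by gcongr
          _ = _ := by field_simp
      have h6 := norm_sub_norm_le (zetaMul s₀) (zetaMul s)
      rw [norm_sub_rev] at h6
      have h7 : 2 * (C * κ * T / B ^ 4) ≤ ‖zetaMul s₀‖ := h2
      linarith
  obtain ⟨c₂, hc₂, hsmall⟩ : ∃ c₂ : ℝ, 0 < c₂ ∧ ∀ s ∈ Set.Icc (1 : ℝ) 2 ×ℂ Set.Icc (-1 : ℝ) 1,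
      c₂ ≤ ‖zetaMul s‖ := by
    have hcomp : IsCompact (Set.Icc (1 : ℝ) 2 ×ℂ Set.Icc (-1 : ℝ) 1) :=
      isCompact_Icc.reProdIm isCompact_Icc
    have hcont : ContinuousOn (fun s ↦ ‖zetaMul s‖) (Set.Icc (1 : ℝ) 2 ×ℂ Set.Icc (-1 : ℝ) 1) :=
      fun z hz ↦ ((differentiableAt_zetaMul (by linarith [hz.1.1])).continuousAt.norm).continuousWithinAt
    obtain ⟨z, hz, hmin⟩ := hcomp.exists_isMinOn ⟨1, by simp [Complex.mem_reProdIm]⟩ hcont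
    exact ⟨‖zetaMul z‖, norm_pos_iff.2 (zetaMul_ne_zero hz.1.1), fun s hs ↦ hmin hs⟩
  refine ⟨min (C * κ) (c₂ / 6), lt_min (by positivity) (by positivity), fun s hs hs' ↦ ?_⟩
  rcases le_total 1 |s.im| with ht | ht
  · refine le_trans ?_ (hlarge s hs hs' ht)
    gcongr
    exact min_le_left _ _
  · refine le_trans ?_ (hsmall s ⟨⟨hs, hs'⟩, abs_le.1 ht⟩)
    have hB : 1 ≤ ((5 + |s.im|) ^ θ) ^ 4 :=
      one_le_pow₀ (Real.one_le_rpow (by linarith [abs_nonneg s.im]) h0.le)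
    calc _ ≤ c₂ / 6 * 6 / 1 := by
          gcongr
          · exact min_le_right _ _
          · linarith
      _ = c₂ := by ring

/-- The function `-(Z'(s) / Z(s)) / (s (s + 1))`, where `Z(s) = (s - 1) ζ(s)`. -/
noncomputable def zetaKernel (s : ℂ) : ℂ := -(deriv zetaMul s / zetaMul s) / (s * (s + 1))

lemma height_le_mul_norm {z : ℂ} (hz : 1 / 2 ≤ z.re) : 5 + |z.im| ≤ 11 * ‖z‖ := by
  linarith [Complex.abs_im_le_norm z, Complex.re_le_norm z]

lemma exists_norm_iteratedDeriv_two_zetaKernel_le :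
    ∃ C : ℝ, 0 < C ∧ ∀ s : ℂ, 1 ≤ s.re → s.re ≤ 2 →
      AnalyticAt ℂ zetaKernel s ∧
        ‖iteratedDeriv 2 zetaKernel s‖ ≤ C * (5 + |s.im|) ^ (-(3 / 2) : ℝ) := by
  have h0 : (0 : ℝ) < 1 / 30 := by norm_num
  have h1 : (1 / 30 : ℝ) ≤ 1 / 2 := by norm_num
  obtain ⟨C, hC, hder⟩ := exists_norm_deriv_zetaMul_le h0 h1
  obtain ⟨c, hc, hlow⟩ := exists_le_norm_zetaMul h0 h1
  set κ := min (1 / 120) (c / (8 * C))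
  have hκ : 0 < κ := lt_min (by norm_num) (by positivity)
  have hκ1 : κ ≤ 1 / 120 := min_le_left _ _
  have hκ2 : κ * (8 * C) ≤ c := by
    rw [← le_div_iff₀ (by positivity)]; exact min_le_right _ _
  refine ⟨2 * (4 * C * 22 ^ 2 / (c / 2)) / κ ^ 2, by positivity, fun s hs hs' ↦ ?_⟩
  set T := 5 + |s.im| with hT
  set B := T ^ (1 / 30 : ℝ) with hBdef
  have hT1 : 5 ≤ T := by have := abs_nonneg s.im; linarith
  have hB : 1 ≤ B := Real.one_le_rpow (by linarith) h0.le
  set r := κ / B ^ 5 with hr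
  have hr0 : 0 < r := by positivity
  have hr1 : r ≤ 1 / 120 := (div_le_self hκ.le (one_le_pow₀ hB)).trans hκ1
  have hre {z : ℂ} (hz : ‖z - s‖ ≤ r) : 1 - 1 / 30 / 4 ≤ z.re ∧ z.re ≤ 3 := by
    have := abs_le.1 (abs_re_sub_le hz)
    constructor <;> linarith
  have hderz {z : ℂ} (hz : ‖z - s‖ ≤ r) : ‖deriv zetaMul z‖ ≤ 4 * C * T * B := by
    have hh := height_le_two_mul (by linarith) hz
    refine (hder z (hre hz).1 (hre hz).2).trans ?_
    calc _ ≤ C * (2 * T) * (2 * B) := by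
          gcongr
          exact rpow_le_two_mul_rpow h0.le (by norm_num) (by positivity) (by positivity) hh
      _ = _ := by ring
  have hlowz {z : ℂ} (hz : ‖z - s‖ ≤ r) : c / 2 * T / B ^ 4 ≤ ‖zetaMul z‖ := by
    have hsub : ‖zetaMul z - zetaMul s‖ ≤ 4 * C * T * B * ‖z - s‖ :=
      Convex.norm_image_sub_le_of_norm_deriv_le (𝕜 := ℂ) (s := Metric.closedBall s r)
        (fun w hw ↦ differentiableAt_zetaMul (by
          have := (hre (by simpa [dist_eq_norm] using hw)).1
          linarith)) (fun w hw ↦ hderz (by simpa [dist_eq_norm] using hw))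
        (convex_closedBall _ _) (by simp [hr0.le]) (by simpa [dist_eq_norm] using hz)
    have h5 : 4 * C * T * B * ‖z - s‖ ≤ c / 2 * T / B ^ 4 := by
      calc 4 * C * T * B * ‖z - s‖ ≤ 4 * C * T * B * (κ / B ^ 5) := by gcongr
        _ = κ * (8 * C) / 2 * T / B ^ 4 := by field_simp; ring
        _ ≤ _ := by gcongr
    have h6 := norm_sub_norm_le (zetaMul s) (zetaMul z)
    rw [norm_sub_rev] at h6
    have h7 : c * T / B ^ 4 ≤ ‖zetaMul s‖ := hlow s hs hs'
    have h8 : c * T / B ^ 4 = 2 * (c / 2 * T / B ^ 4) := by ring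
    linarith
  have hne {z : ℂ} (hz : ‖z - s‖ ≤ r) : zetaMul z ≠ 0 :=
    norm_pos_iff.1 (lt_of_lt_of_le (by positivity) (hlowz hz))
  have hnormz {z : ℂ} (hz : ‖z - s‖ ≤ r) : T / 22 ≤ ‖z‖ ∧ T / 22 ≤ ‖z + 1‖ := by
    have hh : 5 + |s.im| ≤ 2 * (5 + |z.im|) :=
      height_le_two_mul (r := r) (by linarith) (by rwa [norm_sub_rev])
    have h2 := height_le_mul_norm (z := z) (by linarith [(hre hz).1])
    have h3 := height_le_mul_norm (z := z + 1) (by simp; linarith [(hre hz).1])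
    simp only [Complex.add_im, Complex.one_im, add_zero] at h3
    constructor <;> linarith
  have hdiff {z : ℂ} (hz : ‖z - s‖ ≤ r) : DifferentiableAt ℂ zetaKernel z := by
    have hz2 : 1 / 2 < z.re := by linarith [(hre hz).1]
    have ho : IsOpen {w : ℂ | 1 / 2 < w.re} := isOpen_lt continuous_const Complex.continuous_re
    have hd : DifferentiableOn ℂ zetaMul {w : ℂ | 1 / 2 < w.re} :=
      fun w hw ↦ (differentiableAt_zetaMul hw).differentiableWithinAt
    refine (((hd.deriv ho).differentiableAt (ho.mem_nhds hz2)).div (differentiableAt_zetaMul hz2)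
      (hne hz)).neg.div (by fun_prop) (mul_ne_zero ?_ ?_)
    · exact norm_pos_iff.1 (lt_of_lt_of_le (by positivity) (hnormz hz).1)
    · exact norm_pos_iff.1 (lt_of_lt_of_le (by positivity) (hnormz hz).2)
  have hdon : DifferentiableOn ℂ zetaKernel (Metric.closedBall s r) :=
    fun z hz ↦ (hdiff (by simpa [dist_eq_norm] using hz)).differentiableWithinAt
  refine ⟨hdon.analyticAt (Metric.closedBall_mem_nhds s hr0), ?_⟩
  have hbound {z : ℂ} (hz : ‖z - s‖ ≤ r) :
      ‖zetaKernel z‖ ≤ 4 * C * 22 ^ 2 / (c / 2) * B ^ 5 / T ^ 2 := by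
    rw [zetaKernel, norm_div, norm_neg, norm_div, norm_mul]
    calc _ ≤ 4 * C * T * B / (c / 2 * T / B ^ 4) / (T / 22 * (T / 22)) := by
          gcongr
          · exact hderz hz
          · exact hlowz hz
          · exact (hnormz hz).1
          · exact (hnormz hz).2
      _ = _ := by field_simp
  have := Complex.norm_iteratedDeriv_le_of_forall_mem_sphere_norm_le 2 hr0
    (hdon.diffContOnCl_ball subset_rfl)
    (fun z hz ↦ hbound (z := z) (by simpa [dist_eq_norm] using hz.le))
  refine this.trans (le_of_eq ?_)
  have hB15 : B ^ 15 = T ^ (1 / 2 : ℝ) := by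
    rw [hBdef, ← Real.rpow_natCast, ← Real.rpow_mul (by linarith)]
    norm_num
  have hTpow : T ^ (-(3 / 2) : ℝ) = B ^ 15 / T ^ 2 := by
    rw [hB15, ← Real.rpow_natCast T 2, ← Real.rpow_sub (by linarith)]
    norm_num
  rw [hTpow, hr]
  simp only [Nat.factorial]
  push_cast
  field_simp

end Bounds

section Laplace

open MeasureTheory

open scoped ArithmeticFunction.vonMangoldt FourierTransform

/-- The integral `∑ Λ(n) (x - n)₊` of the Chebyshev function `ψ` over `[0, x]`. -/
noncomputable def psiIntegral (x : ℝ) : ℝ := ∑' n : ℕ, Λ n * max (x - n) 0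

lemma psiIntegral_eq_sum {x : ℝ} {N : ℕ} (h : x ≤ N) :
    psiIntegral x = ∑ n ∈ Finset.range N, Λ n * max (x - n) 0 := by
  refine tsum_eq_sum fun n hn ↦ ?_
  have : (N : ℝ) ≤ n := by exact_mod_cast not_lt.1 (Finset.mem_range.not.1 hn)
  rw [max_eq_right (by linarith), mul_zero]

lemma continuous_psiIntegral : Continuous psiIntegral := by
  refine continuous_iff_continuousAt.2 fun x ↦ ?_
  obtain ⟨N, hN⟩ := exists_nat_gt x
  have h : psiIntegral =ᶠ[nhds x] fun x ↦ ∑ n ∈ Finset.range N, Λ n * max (x - n) 0 := by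
    filter_upwards [eventually_lt_nhds hN] with y hy using psiIntegral_eq_sum hy.le
  refine ContinuousAt.congr ?_ h.symm
  fun_prop

lemma psiIntegral_nonneg (x : ℝ) : 0 ≤ psiIntegral x :=
  tsum_nonneg fun _ ↦ mul_nonneg ArithmeticFunction.vonMangoldt_nonneg (le_max_right _ _)

lemma psiIntegral_of_le_one {x : ℝ} (hx : x ≤ 1) : psiIntegral x = 0 := by
  rw [psiIntegral_eq_sum (N := 1) (by simpa using hx)]
  simp

lemma sum_range_vonMangoldt (x : ℝ) :
    ∑ n ∈ Finset.range (⌊x⌋₊ + 1), Λ n = Chebyshev.psi x := by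
  rw [Chebyshev.psi_eq_sum_Icc, Nat.range_succ_eq_Icc_zero]

lemma psiIntegral_le {x : ℝ} (hx : 0 ≤ x) : psiIntegral x ≤ (log 4 + 4) * x ^ 2 := by
  rw [psiIntegral_eq_sum (N := ⌊x⌋₊ + 1) (by exact_mod_cast (Nat.lt_floor_add_one x).le)]
  calc _ ≤ ∑ n ∈ Finset.range (⌊x⌋₊ + 1), Λ n * x := by
        gcongr with n
        exact max_le (by linarith [(Nat.cast_nonneg n : (0 : ℝ) ≤ n)]) hx
    _ = Chebyshev.psi x * x := by rw [← Finset.sum_mul, sum_range_vonMangoldt]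
    _ ≤ (log 4 + 4) * x * x := by gcongr; exact Chebyshev.psi_le_const_mul_self hx
    _ = _ := by ring

/-- The difference between `∑ Λ(n) (x - n)₊` and its main term, at `x = exp u`. -/
noncomputable def psiError (u : ℝ) : ℝ := psiIntegral (exp u) - max (exp u - 1) 0 ^ 2 / 2

lemma continuous_psiError : Continuous psiError :=
  (continuous_psiIntegral.comp continuous_exp).sub (by fun_prop)

lemma psiError_of_nonpos {u : ℝ} (hu : u ≤ 0) : psiError u = 0 := by
  have : exp u ≤ 1 := Real.exp_le_one_iff.2 hu
  rw [psiError, psiIntegral_of_le_one this, max_eq_right (by linarith)]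
  simp

lemma abs_psiError_le (u : ℝ) : |psiError u| ≤ (log 4 + 4) * exp (2 * u) := by
  have h1 := psiIntegral_le (exp_pos u).le
  have h2 := psiIntegral_nonneg (exp u)
  have h3 : max (exp u - 1) 0 ≤ exp u := max_le (by linarith) (exp_pos u).le
  have h4 : max (exp u - 1) 0 ^ 2 ≤ exp u ^ 2 := by gcongr
  have h5 : 0 ≤ log 4 := log_nonneg (by norm_num)
  have h6 : exp (2 * u) = exp u ^ 2 := by rw [two_mul, exp_add, sq]
  have h7 : 0 ≤ max (exp u - 1) 0 ^ 2 := by positivity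
  rw [h6, psiError, abs_le]
  constructor <;> nlinarith

lemma integrable_pow_mul_exp {g : ℝ → ℝ} (hg : Continuous g) (h0 : ∀ u ≤ 0, g u = 0) {C : ℝ}
    (hC : ∀ u, |g u| ≤ C * exp (2 * u)) {s : ℂ} (hs : 1 < s.re) (k : ℕ) :
    Integrable fun u : ℝ ↦ u ^ k • ((g u : ℂ) * Complex.exp (-(s + 1) * u)) := by
  have hb : IntegrableOn (fun u : ℝ ↦ C * (u ^ (k : ℝ) * exp (-(s.re - 1) * u ^ (1 : ℝ))))
      (Set.Ioi 0) :=
    (integrableOn_rpow_mul_exp_neg_mul_rpow (by linarith [(Nat.cast_nonneg k : (0 : ℝ) ≤ k)])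
      one_pos (by linarith)).const_mul C
  refine (hb.integrable_indicator measurableSet_Ioi).mono'
    (Continuous.aestronglyMeasurable (by fun_prop)) (Eventually.of_forall fun u ↦ ?_)
  rcases le_or_gt u 0 with hu | hu
  · simp [h0 u hu, Set.indicator_of_notMem (show u ∉ Set.Ioi 0 by simpa using hu)]
  · rw [Set.indicator_of_mem (Set.mem_Ioi.2 hu), norm_smul, norm_mul, Complex.norm_exp,
      Complex.norm_real, Real.norm_eq_abs, Real.norm_eq_abs, abs_of_pos (by positivity),
      rpow_natCast, rpow_one]
    have he : exp (-(s.re - 1) * u) = exp (2 * u) * exp (-(s.re + 1) * u) := by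
      rw [← exp_add]; ring_nf
    have hre : (-(s + 1) * (u : ℂ)).re = -(s.re + 1) * u := by simp
    rw [hre, he]
    calc _ ≤ u ^ k * (C * exp (2 * u) * exp (-(s.re + 1) * u)) := by gcongr; exact hC u
      _ = _ := by ring

lemma hasIntegral_exp_Ioi {a : ℂ} (ha : 0 < a.re) (c : ℝ) :
    IntegrableOn (fun u : ℝ ↦ Complex.exp (-a * u)) (Set.Ioi c) ∧
      ∫ u in Set.Ioi c, Complex.exp (-a * u) = Complex.exp (-a * c) / a :=
  ⟨integrableOn_exp_mul_complex_Ioi (by simpa using ha) c, by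
    rw [integral_exp_mul_complex_Ioi (by simpa using ha), neg_div_neg_eq]⟩

lemma integral_truncated_exp {s : ℂ} (hs : 0 < s.re) (c : ℝ) :
    Integrable (fun u : ℝ ↦ ((max (exp u - exp c) 0 : ℝ) : ℂ) * Complex.exp (-(s + 1) * u)) ∧
      ∫ u : ℝ, ((max (exp u - exp c) 0 : ℝ) : ℂ) * Complex.exp (-(s + 1) * u)
        = Complex.exp (-s * c) / (s * (s + 1)) := by
  have hs1 : 0 < (s + 1).re := by simp; linarith
  have h0 : s ≠ 0 := fun h ↦ by simp [h] at hs
  have h1 : s + 1 ≠ 0 := fun h ↦ by simp [h] at hs1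
  obtain ⟨i0, e0⟩ := hasIntegral_exp_Ioi hs c
  obtain ⟨i1, e1⟩ := hasIntegral_exp_Ioi hs1 c
  have hfun : (fun u : ℝ ↦ ((max (exp u - exp c) 0 : ℝ) : ℂ) * Complex.exp (-(s + 1) * u)) =
      (Set.Ioi c).indicator (fun u : ℝ ↦ Complex.exp (-s * u)
        - Complex.exp c * Complex.exp (-(s + 1) * u)) := by
    ext u
    by_cases hu : c < u
    · rw [Set.indicator_of_mem (Set.mem_Ioi.2 hu),
        max_eq_left (sub_nonneg.2 (Real.exp_le_exp.2 hu.le))]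
      push_cast
      rw [sub_mul, ← Complex.exp_add]
      ring_nf
    · rw [Set.indicator_of_notMem (by simpa using hu),
        max_eq_right (sub_nonpos.2 (Real.exp_le_exp.2 (not_lt.1 hu)))]
      simp
  rw [hfun]
  refine ⟨(i0.sub (i1.const_mul _)).integrable_indicator measurableSet_Ioi, ?_⟩
  rw [integral_indicator measurableSet_Ioi, integral_sub i0 (i1.const_mul _), integral_const_mul,
    e0, e1, ← mul_div_assoc, ← Complex.exp_add, show (c : ℂ) + -(s + 1) * c = -s * c by ring]
  field_simp
  ring

lemma integral_truncated_exp_sq {s : ℂ} (hs : 1 < s.re) :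
    Integrable (fun u : ℝ ↦ ((max (exp u - 1) 0 ^ 2 / 2 : ℝ) : ℂ) * Complex.exp (-(s + 1) * u)) ∧
      ∫ u : ℝ, ((max (exp u - 1) 0 ^ 2 / 2 : ℝ) : ℂ) * Complex.exp (-(s + 1) * u)
        = 1 / (s - 1) / (s * (s + 1)) := by
  have hsm : 0 < (s - 1).re := by simp; linarith
  have hs0 : 0 < s.re := by linarith
  have hs1 : 0 < (s + 1).re := by simp; linarith
  have hm : s - 1 ≠ 0 := fun h ↦ by simp [h] at hsm
  have h0 : s ≠ 0 := fun h ↦ by simp [h] at hs0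
  have h1 : s + 1 ≠ 0 := fun h ↦ by simp [h] at hs1
  obtain ⟨im, em⟩ := hasIntegral_exp_Ioi hsm 0
  obtain ⟨i0, e0⟩ := hasIntegral_exp_Ioi hs0 0
  obtain ⟨i1, e1⟩ := hasIntegral_exp_Ioi hs1 0
  have hfun : (fun u : ℝ ↦ ((max (exp u - 1) 0 ^ 2 / 2 : ℝ) : ℂ) * Complex.exp (-(s + 1) * u)) =
      (Set.Ioi (0 : ℝ)).indicator (fun u : ℝ ↦ 1 / 2 * Complex.exp (-(s - 1) * u)
        - Complex.exp (-s * u) + 1 / 2 * Complex.exp (-(s + 1) * u)) := by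
    ext u
    by_cases hu : 0 < u
    · rw [Set.indicator_of_mem (Set.mem_Ioi.2 hu),
        max_eq_left (sub_nonneg.2 (Real.one_le_exp hu.le))]
      rw [show -(s - 1) * u = u + u + -(s + 1) * u by ring, show -s * u = u + -(s + 1) * u by ring]
      simp only [Complex.exp_add]
      push_cast
      ring
    · rw [Set.indicator_of_notMem (by simpa using hu),
        max_eq_right (sub_nonpos.2 (Real.exp_le_one_iff.2 (not_lt.1 hu)))]
      simp
  rw [hfun]
  have hsub : IntegrableOn (fun u : ℝ ↦ 1 / 2 * Complex.exp (-(s - 1) * u) - Complex.exp (-s * u))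
      (Set.Ioi 0) := (im.const_mul _).sub i0
  have hadd : IntegrableOn (fun u : ℝ ↦ 1 / 2 * Complex.exp (-(s - 1) * u) - Complex.exp (-s * u)
      + 1 / 2 * Complex.exp (-(s + 1) * u)) (Set.Ioi 0) := hsub.add (i1.const_mul _)
  refine ⟨hadd.integrable_indicator measurableSet_Ioi, ?_⟩
  rw [integral_indicator measurableSet_Ioi, integral_add hsub (i1.const_mul _),
    integral_sub (im.const_mul _) i0, integral_const_mul, integral_const_mul, em, e0, e1]
  simp only [Complex.ofReal_zero, mul_zero, Complex.exp_zero]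
  field_simp
  ring

lemma zetaKernel_eq {s : ℂ} (hs : 1 < s.re) :
    zetaKernel s = (LSeries (fun n ↦ ((Λ n : ℝ) : ℂ)) s - 1 / (s - 1)) / (s * (s + 1)) := by
  have hs1 : s ≠ 1 := fun h ↦ by simp [h] at hs
  have hsub : s - 1 ≠ 0 := sub_ne_zero.2 hs1
  have hz : riemannZeta s ≠ 0 := riemannZeta_ne_zero_of_one_le_re hs.le
  have hd : deriv zetaMul s = riemannZeta s + (s - 1) * deriv riemannZeta s := by
    have ho : IsOpen {w : ℂ | 1 < w.re} := isOpen_lt continuous_const Complex.continuous_re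
    have heq : zetaMul =ᶠ[nhds s] fun w ↦ (w - 1) * riemannZeta w := by
      filter_upwards [ho.mem_nhds hs] with w hw using zetaMul_eq hw
    rw [heq.deriv_eq, deriv_fun_mul (by fun_prop) (differentiableAt_riemannZeta hs1)]
    simp
  rw [ArithmeticFunction.LSeries_vonMangoldt_eq_deriv_riemannZeta_div hs, zetaKernel, hd, zetaMul_eq hs]
  congr 1
  field_simp
  ring

lemma integral_psiError {s : ℂ} (hs : 1 < s.re) :
    ∫ u : ℝ, (psiError u : ℂ) * Complex.exp (-(s + 1) * u) = zetaKernel s := by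
  have hs0 : 0 < s.re := by linarith
  set f : ℕ → ℝ → ℂ := fun n u ↦
    (Λ n : ℂ) * (((max (exp u - n) 0 : ℝ) : ℂ) * Complex.exp (-(s + 1) * u)) with hf
  have hterm {z : ℂ} (hz : 0 < z.re) (n : ℕ) :
      Integrable (fun u : ℝ ↦ (Λ n : ℂ) * (((max (exp u - n) 0 : ℝ) : ℂ) *
        Complex.exp (-(z + 1) * u))) ∧
      ∫ u : ℝ, (Λ n : ℂ) * (((max (exp u - n) 0 : ℝ) : ℂ) * Complex.exp (-(z + 1) * u))
        = LSeries.term (fun n ↦ ((Λ n : ℝ) : ℂ)) z n / (z * (z + 1)) := by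
    rcases Nat.eq_zero_or_pos n with rfl | hn
    · simp
    · have hn' : (0 : ℝ) < n := by exact_mod_cast hn
      obtain ⟨hi, he⟩ := integral_truncated_exp hz (log n)
      rw [Real.exp_log hn'] at hi he
      refine ⟨hi.const_mul _, ?_⟩
      rw [integral_const_mul, he, LSeries.term_of_ne_zero hn.ne',
        Complex.cpow_def_of_ne_zero (by exact_mod_cast hn.ne'), Complex.ofReal_log hn'.le,
        neg_mul, Complex.exp_neg, mul_comm z]
      simp only [Complex.ofReal_natCast]
      ring
  have hnorm (n : ℕ) : ∫ u, ‖f n u‖ = Λ n / (n : ℝ) ^ s.re / (s.re * (s.re + 1)) := by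
    have h1 (u : ℝ) : ((‖f n u‖ : ℝ) : ℂ) = (Λ n : ℂ) * (((max (exp u - n) 0 : ℝ) : ℂ) *
        Complex.exp (-((s.re : ℂ) + 1) * u)) := by
      simp only [hf]
      rw [norm_mul, norm_mul, Complex.norm_exp, Complex.norm_real, Complex.norm_real,
        Real.norm_of_nonneg ArithmeticFunction.vonMangoldt_nonneg, Real.norm_of_nonneg (le_max_right _ _)]
      push_cast
      simp
    have h2 := (hterm (z := (s.re : ℂ)) (by simpa using hs0) n).2
    simp only [← h1] at h2
    rw [integral_complex_ofReal] at h2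
    apply Complex.ofReal_injective
    rw [h2]
    rcases Nat.eq_zero_or_pos n with rfl | hn
    · simp
    · rw [LSeries.term_of_ne_zero hn.ne']
      push_cast
      rw [Complex.ofReal_cpow (Nat.cast_nonneg n)]
      simp
  have hLs : LSeriesSummable (fun n ↦ ((Λ n : ℝ) : ℂ)) s := ArithmeticFunction.LSeriesSummable_vonMangoldt hs
  have hsum : Summable fun n ↦ ∫ u, ‖f n u‖ := by
    simp only [hnorm]
    refine Summable.div_const (hLs.norm.congr fun n ↦ ?_) _
    rw [LSeries.norm_term_eq]
    split_ifs with h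
    · simp [h]
    · rw [Complex.norm_real, Real.norm_of_nonneg ArithmeticFunction.vonMangoldt_nonneg]
  have hmain := hasSum_integral_of_summable_integral_norm (F := f) (μ := volume)
    (fun n ↦ (hterm hs0 n).1) hsum
  have hL : HasSum (fun n ↦ ∫ u, f n u)
      (LSeries (fun n ↦ ((Λ n : ℝ) : ℂ)) s / (s * (s + 1))) := by
    simp only [hf, (hterm hs0 _).2]
    exact hLs.hasSum.div_const _
  have htsum (u : ℝ) : ∑' n, f n u = (psiIntegral (exp u) : ℂ) * Complex.exp (-(s + 1) * u) := by
    rw [psiIntegral, Complex.ofReal_tsum, ← tsum_mul_right]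
    refine tsum_congr fun n ↦ ?_
    simp only [hf]
    push_cast
    ring
  have hval := hmain.unique hL
  simp only [htsum] at hval
  obtain ⟨hqi, hqe⟩ := integral_truncated_exp_sq hs
  have hpi : Integrable fun u : ℝ ↦ (psiIntegral (exp u) : ℂ) * Complex.exp (-(s + 1) * u) := by
    refine (integrable_pow_mul_exp (continuous_psiIntegral.comp continuous_exp) (C := log 4 + 4)
      (fun u hu ↦ psiIntegral_of_le_one (Real.exp_le_one_iff.2 hu)) (fun u ↦ ?_) hs 0).congr
      (Eventually.of_forall fun u ↦ by simp)
    rw [Function.comp_apply, abs_of_nonneg (psiIntegral_nonneg _), two_mul, exp_add, ← sq]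
    exact psiIntegral_le (exp_pos u).le
  rw [zetaKernel_eq hs, sub_div, ← hval, ← hqe, ← integral_sub hpi hqi]
  refine integral_congr_ae (Eventually.of_forall fun u ↦ ?_)
  simp only [psiError]
  push_cast
  ring

lemma fourier_psiError {σ : ℝ} (hσ : 1 < σ) (w : ℝ) :
    𝓕 (fun u : ℝ ↦ (psiError u : ℂ) * Complex.exp (-((σ : ℂ) + 1) * u)) w
      = zetaKernel (σ + 2 * π * Complex.I * w) := by
  rw [fourier_real_eq_integral_exp_smul, ← integral_psiError (by simpa using hσ)]
  congr 1 with u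
  rw [smul_eq_mul, mul_left_comm, ← Complex.exp_add]
  congr 2
  push_cast
  ring

lemma iteratedDeriv_two_comp_line {f : ℂ → ℂ} {a b : ℂ}
    (hf : ∀ w : ℝ, AnalyticAt ℂ f (a + b * w)) (w : ℝ) :
    iteratedDeriv 2 (fun w : ℝ ↦ f (a + b * w)) w = b ^ 2 * iteratedDeriv 2 f (a + b * w) := by
  have h {g : ℂ → ℂ} (hg : ∀ w : ℝ, AnalyticAt ℂ g (a + b * w)) (w : ℝ) :
      HasDerivAt (fun w : ℝ ↦ g (a + b * w)) (b * deriv g (a + b * w)) w := by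
    have h1 : HasDerivAt (fun z : ℂ ↦ a + b * z) b w := by
      simpa using ((hasDerivAt_id (w : ℂ)).const_mul b).const_add a
    have := ((hg w).differentiableAt.hasDerivAt.comp (w : ℂ) h1).comp_ofReal
    simpa [mul_comm] using! this
  have h1 : deriv (fun w : ℝ ↦ f (a + b * w)) = fun w : ℝ ↦ b * deriv f (a + b * w) :=
    funext fun w ↦ (h hf w).deriv
  rw [iteratedDeriv_succ, iteratedDeriv_one, h1, iteratedDeriv_succ, iteratedDeriv_one,
    ((h (fun w ↦ (hf w).deriv) w).const_mul b).deriv]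
  ring

lemma exists_sq_mul_abs_psiError_le : ∃ C, ∀ u, u ^ 2 * |psiError u| ≤ C * exp (2 * u) := by
  obtain ⟨C, hC, hker⟩ := exists_norm_iteratedDeriv_two_zetaKernel_le
  set B : ℝ → ℝ := fun w ↦ (2 * π) ^ 2 * (C * (1 + ‖w‖) ^ (-(3 / 2) : ℝ)) with hB
  have hBint : Integrable B :=
    ((integrable_one_add_norm (by norm_num)).const_mul C).const_mul _
  have key {σ : ℝ} (h1 : 1 < σ) (h2 : σ ≤ 2) (u : ℝ) :
      (2 * π) ^ 2 * (u ^ 2 * |psiError u| * exp (-(σ + 1) * u)) ≤ ∫ w, B w := by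
    set F : ℝ → ℂ := fun u ↦ (psiError u : ℂ) * Complex.exp (-((σ : ℂ) + 1) * u) with hF
    have hcont : Continuous psiError := continuous_psiError
    have hFi (k : ℕ) : Integrable fun u : ℝ ↦ u ^ k • F u :=
      integrable_pow_mul_exp continuous_psiError (fun _ ↦ psiError_of_nonpos) abs_psiError_le
        (by simpa using h1) k
    have hF2 := iteratedDeriv_fourier (f := F) (N := 2) (n := 2) (fun n _ ↦ hFi n) le_rfl
    set G : ℝ → ℂ := fun x : ℝ ↦ (-2 * π * Complex.I * x) ^ 2 • F x with hG
    have hGc : Continuous G := by fun_prop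
    have hGi : Integrable G := by
      refine ((hFi 2).const_mul ((-2 * π * Complex.I) ^ 2)).congr (Eventually.of_forall fun x ↦ ?_)
      simp only [hG, Complex.real_smul, smul_eq_mul]
      push_cast
      ring
    have hline (w : ℝ) : ((σ : ℂ) + 2 * π * Complex.I * w).re = σ := by simp
    have him (w : ℝ) : ((σ : ℂ) + 2 * π * Complex.I * w).im = 2 * π * w := by simp
    have hbound (w : ℝ) : ‖𝓕 G w‖ ≤ B w := by
      have hFF : 𝓕 F = fun w : ℝ ↦ zetaKernel (σ + 2 * π * Complex.I * w) :=
        funext (fourier_psiError h1)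
      rw [← hF2, hFF, iteratedDeriv_two_comp_line
        (fun w ↦ (hker _ (by rw [hline]; exact h1.le) (by rw [hline]; exact h2)).1), norm_mul]
      have h3 := (hker (σ + 2 * π * Complex.I * w) (by rw [hline]; exact h1.le)
        (by rw [hline]; exact h2)).2
      rw [him] at h3
      have h4 : ‖(2 * π * Complex.I) ^ 2‖ = (2 * π) ^ 2 := by
        simp [abs_of_pos pi_pos]
      rw [h4]
      have h5 : 1 + ‖w‖ ≤ 5 + |2 * π * w| := by
        rw [abs_mul, abs_of_pos two_pi_pos, Real.norm_eq_abs]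
        nlinarith [abs_nonneg w, pi_gt_three]
      refine mul_le_mul_of_nonneg_left (h3.trans ?_) (by positivity)
      gcongr ?_ * ?_
      exact rpow_le_rpow_of_nonpos (by positivity) h5 (by norm_num)
    have hFGi : Integrable (𝓕 G) := by
      refine hBint.mono' ?_ (Eventually.of_forall hbound)
      exact (VectorFourier.fourierIntegral_continuous continuous_fourierChar
        (by fun_prop) hGi).aestronglyMeasurable
    have hinv := congrFun (hGc.fourierInv_fourier_eq hGi hFGi) u
    have hnorm : ‖G u‖ ≤ ∫ w, B w := by
      rw [← hinv, fourierInv_eq]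
      refine (norm_integral_le_integral_norm _).trans ?_
      refine integral_mono_of_nonneg (Eventually.of_forall fun _ ↦ norm_nonneg _) hBint
        (Eventually.of_forall fun w ↦ ?_)
      simpa using hbound w
    refine le_trans (le_of_eq ?_) hnorm
    simp only [hG, hF, smul_eq_mul, norm_mul, norm_pow, Complex.norm_exp, Complex.norm_real,
      Real.norm_eq_abs]
    simp only [← Complex.ofReal_ofNat, Complex.norm_I, Complex.norm_real, norm_neg,
      Real.norm_eq_abs, abs_of_pos pi_pos, mul_pow, sq_abs]
    simp
    ring_nf
  refine ⟨(∫ w, B w) / (2 * π) ^ 2, fun u ↦ ?_⟩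
  have hlim : Tendsto (fun σ : ℝ ↦ (2 * π) ^ 2 * (u ^ 2 * |psiError u| * exp (-(σ + 1) * u)))
      (nhdsWithin 1 (Set.Ioi 1))
      (nhds ((2 * π) ^ 2 * (u ^ 2 * |psiError u| * exp (-(1 + 1) * u)))) :=
    (Continuous.tendsto (by fun_prop) 1).mono_left nhdsWithin_le_nhds
  have h := le_of_tendsto hlim (by
    filter_upwards [Ioc_mem_nhdsGT (show (1 : ℝ) < 2 by norm_num)] with σ hσ using key hσ.1 hσ.2 u)
  have he : exp (-(1 + 1) * u) * exp (2 * u) = 1 := by rw [← exp_add]; ring_nf; simp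
  rw [div_mul_eq_mul_div, le_div_iff₀ (by positivity)]
  calc u ^ 2 * |psiError u| * (2 * π) ^ 2
      = (2 * π) ^ 2 * (u ^ 2 * |psiError u| * exp (-(1 + 1) * u)) * exp (2 * u) := by
        linear_combination (-(u ^ 2 * |psiError u| * (2 * π) ^ 2)) * he
    _ ≤ _ := by gcongr

end Laplace

section PrimeNumberTheorem

open scoped ArithmeticFunction.vonMangoldt

lemma mul_psi_le_psiIntegral_sub {x : ℝ} (hx : 0 ≤ x) (y : ℝ) :
    (y - x) * Chebyshev.psi x ≤ psiIntegral y - psiIntegral x := by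
  set N := max (⌊x⌋₊ + 1) ⌈y⌉₊ with hN
  have hxN : x ≤ N := (Nat.lt_floor_add_one x).le.trans (by exact_mod_cast le_max_left _ _)
  have hyN : y ≤ N := (Nat.le_ceil y).trans (by exact_mod_cast le_max_right _ _)
  have hpsi : Chebyshev.psi x = ∑ n ∈ Finset.range N, if (n : ℝ) ≤ x then Λ n else 0 := by
    rw [← sum_range_vonMangoldt, ← Finset.sum_filter]
    congr 1
    ext n
    rw [Finset.mem_filter, Finset.mem_range, Finset.mem_range, ← Nat.le_floor_iff hx]
    lia
  rw [hpsi, psiIntegral_eq_sum hxN, psiIntegral_eq_sum hyN, Finset.mul_sum,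
    ← Finset.sum_sub_distrib]
  refine Finset.sum_le_sum fun n _ ↦ ?_
  have hΛ : 0 ≤ Λ n := ArithmeticFunction.vonMangoldt_nonneg
  rw [← mul_sub]
  split_ifs with h
  · rw [max_eq_left (by linarith : 0 ≤ x - n), mul_comm]
    exact mul_le_mul_of_nonneg_left (by linarith [le_max_left (y - n) 0]) hΛ
  · rw [max_eq_right (by linarith : x - n ≤ 0), mul_zero, sub_zero]
    positivity

lemma exists_abs_psiIntegral_sub_le : ∃ C, 0 ≤ C ∧ ∀ x, 1 < x →
    |psiIntegral x - x ^ 2 / 2| ≤ C * (x / log x) ^ 2 := by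
  obtain ⟨C, hC⟩ := exists_sq_mul_abs_psiError_le
  refine ⟨|C| + 4, by positivity, fun x hx ↦ ?_⟩
  have hx0 : 0 < x := by linarith
  have hL : 0 < log x := log_pos hx
  have h := hC (log x)
  rw [psiError, two_mul, exp_add, exp_log hx0, max_eq_left (by linarith : 0 ≤ x - 1)] at h
  have hlog : log x ^ 2 ≤ 4 * x := by
    have h1 : log x ≤ 2 * √x := by
      have := Real.log_le_sub_one_of_pos (Real.sqrt_pos.2 hx0)
      rw [Real.log_sqrt hx0.le] at this
      linarith
    calc log x ^ 2 ≤ (2 * √x) ^ 2 := by gcongr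
      _ = 4 * x := by rw [mul_pow, Real.sq_sqrt hx0.le]; norm_num
  have htri : |psiIntegral x - x ^ 2 / 2| ≤ |psiIntegral x - (x - 1) ^ 2 / 2| + x := by
    rw [abs_le]
    have h1 := neg_abs_le (psiIntegral x - (x - 1) ^ 2 / 2)
    have h2 := le_abs_self (psiIntegral x - (x - 1) ^ 2 / 2)
    constructor <;> nlinarith
  rw [div_pow, ← mul_div_assoc, le_div_iff₀ (by positivity)]
  calc |psiIntegral x - x ^ 2 / 2| * log x ^ 2
      ≤ (|psiIntegral x - (x - 1) ^ 2 / 2| + x) * log x ^ 2 := by gcongr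
    _ = log x ^ 2 * |psiIntegral x - (x - 1) ^ 2 / 2| + x * log x ^ 2 := by ring
    _ ≤ |C| * (x * x) + x * (4 * x) := by
      refine add_le_add (h.trans ?_) (by gcongr)
      gcongr
      exact le_abs_self C
    _ = _ := by ring

/-- The prime number theorem for `ψ`, with a saving of one logarithm. -/
lemma psi_sub_id_isBigO : (fun x ↦ Chebyshev.psi x - x) =O[atTop] fun x ↦ x / log x := by
  obtain ⟨C, hC0, hC⟩ := exists_abs_psiIntegral_sub_le
  refine IsBigO.of_bound (1 / 2 + 5 * C) ?_
  filter_upwards [eventually_ge_atTop (exp 2)] with x hx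
  have hx0 : 0 < x := (exp_pos 2).trans_le hx
  have hL : 2 ≤ log x := (le_log_iff_exp_le hx0).2 hx
  have hL0 : 0 < log x := by linarith
  have hx3 : 3 ≤ x := by linarith [add_one_le_exp (2 : ℝ)]
  set h := x / log x with hh
  have hpos : 0 < h := by positivity
  have hhalf : h ≤ x / 2 := by rw [hh]; gcongr
  have h0 := abs_le.1 (hC x (by linarith))
  have hplus : |psiIntegral (x + h) - (x + h) ^ 2 / 2| ≤ C * (9 / 4 * h ^ 2) := by
    refine (hC (x + h) (by linarith)).trans ?_
    gcongr
    have h1 : (x + h) / log (x + h) ≤ 3 / 2 * h := by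
      rw [hh, ← mul_div_assoc, ← hh]
      gcongr <;> linarith
    calc ((x + h) / log (x + h)) ^ 2 ≤ (3 / 2 * h) ^ 2 := by
          gcongr
          exact div_nonneg (by linarith) (log_nonneg (by linarith))
      _ = _ := by ring
  have hminus : |psiIntegral (x - h) - (x - h) ^ 2 / 2| ≤ C * (4 * h ^ 2) := by
    refine (hC (x - h) (by linarith)).trans ?_
    gcongr
    have hl : log x / 2 ≤ log (x - h) := by
      have h2 : log (x / 2) ≤ log (x - h) := log_le_log (by linarith) (by linarith)
      rw [log_div hx0.ne' two_ne_zero] at h2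
      linarith [log_two_lt_d9]
    have h1 : (x - h) / log (x - h) ≤ 2 * h := by
      calc (x - h) / log (x - h) ≤ x / (log x / 2) := by gcongr; linarith
        _ = 2 * h := by rw [hh]; field_simp
    calc ((x - h) / log (x - h)) ^ 2 ≤ (2 * h) ^ 2 := by
          gcongr
          exact div_nonneg (by linarith) (by linarith)
      _ = _ := by ring
  have hplus' := abs_le.1 hplus
  have hminus' := abs_le.1 hminus
  have hup := mul_psi_le_psiIntegral_sub hx0.le (x + h)
  have hdown := mul_psi_le_psiIntegral_sub hx0.le (x - h)
  rw [Real.norm_eq_abs, Real.norm_of_nonneg hpos.le, abs_le]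
  have hCh : 0 ≤ C * h ^ 2 := by positivity
  constructor
  · refine le_of_mul_le_mul_left ?_ hpos
    nlinarith
  · refine le_of_mul_le_mul_left ?_ hpos
    nlinarith

/-- The prime number theorem, with a saving of one logarithm. -/
lemma primeCounting_sub_isBigO :
    (fun x : ℝ ↦ (Nat.primeCounting ⌊x⌋₊ : ℝ) - x / log x) =O[atTop] fun x ↦ x / log x ^ 2 := by
  have hsqrt : (fun x : ℝ ↦ √x) =O[atTop] fun x ↦ x / log x := by
    refine IsBigO.of_bound 2 ?_
    filter_upwards [eventually_gt_atTop 1] with x hx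
    have hx0 : 0 < x := by linarith
    have hL := log_pos hx
    have h1 := Real.log_le_sub_one_of_pos (Real.sqrt_pos.2 hx0)
    rw [Real.log_sqrt hx0.le] at h1
    rw [norm_of_nonneg (sqrt_nonneg x), norm_of_nonneg (by positivity), ← mul_div_assoc,
      le_div_iff₀ hL]
    nlinarith [Real.mul_self_sqrt hx0.le, Real.sqrt_nonneg x]
  have htheta : (fun x ↦ Chebyshev.theta x - x) =O[atTop] fun x ↦ x / log x :=
    (psi_sub_id_isBigO.sub (Chebyshev.isBigO_psi_sub_theta_sqrt.trans hsqrt)).congr_left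
      fun x ↦ by rw [Pi.sub_apply]; ring
  have hdiv : (fun x ↦ (Chebyshev.theta x - x) * (log x)⁻¹) =O[atTop]
      fun x ↦ x / log x * (log x)⁻¹ := htheta.mul (isBigO_refl _ _)
  refine (Chebyshev.primeCounting_sub_theta_div_log_isBigO.add
    (hdiv.congr_right fun x ↦ ?_)).congr_left fun x ↦ ?_
  · rw [sq, div_mul_eq_div_div, div_eq_mul_inv (x / log x)]
  · ring

end PrimeNumberTheorem

section NthPrime

lemma primeCounting_nthPrime {n : ℕ} (hn : n ≠ 0) : Nat.primeCounting (nthPrime n) = n := by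
  have h : Nat.Prime (nthPrime n) := Nat.prime_nth_prime _
  have h2 := Nat.primeCounting'_nth_eq (n - 1)
  rw [Nat.primeCounting'] at h2
  rw [Nat.primeCounting, Nat.primeCounting', Nat.count_succ, if_pos h, nthPrime, h2]
  lia

lemma tendsto_nthPrime : Tendsto nthPrime atTop atTop :=
  tendsto_atTop_mono (fun n ↦ by have := Nat.add_two_le_nth_prime (n - 1); simp only [nthPrime, id]; lia)
    tendsto_id

lemma tendsto_natCast_nthPrime : Tendsto (fun n ↦ (nthPrime n : ℝ)) atTop atTop :=
  tendsto_natCast_atTop_atTop.comp tendsto_nthPrime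

lemma isBigO_sub_nthPrime_div_log :
    (fun n : ℕ ↦ (n : ℝ) - nthPrime n / log (nthPrime n)) =O[atTop]
      fun n ↦ (nthPrime n : ℝ) / log (nthPrime n) ^ 2 := by
  refine (primeCounting_sub_isBigO.comp_tendsto tendsto_natCast_nthPrime).congr' ?_ .rfl
  filter_upwards [eventually_ne_atTop 0] with n hn
  simp [primeCounting_nthPrime hn]

lemma tendsto_log_nthPrime : Tendsto (fun n ↦ log (nthPrime n)) atTop atTop :=
  tendsto_log_atTop.comp tendsto_natCast_nthPrime

/-- The ratio `n log p_n / p_n` differs from `1` by `O(1 / log p_n)`. -/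
lemma isBigO_mul_log_div_nthPrime_sub_one :
    (fun n : ℕ ↦ n * log (nthPrime n) / nthPrime n - 1) =O[atTop]
      fun n ↦ (log (nthPrime n))⁻¹ := by
  refine ((isBigO_refl (fun n : ℕ ↦ log (nthPrime n) / nthPrime n) atTop).mul
    isBigO_sub_nthPrime_div_log).congr' ?_ ?_
  all_goals
    filter_upwards [tendsto_log_nthPrime.eventually_gt_atTop 0,
      tendsto_natCast_nthPrime.eventually_gt_atTop 0] with n h1 h2
    field_simp

lemma tendsto_mul_log_div_nthPrime :
    Tendsto (fun n : ℕ ↦ n * log (nthPrime n) / nthPrime n) atTop (nhds 1) := by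
  have h := isBigO_mul_log_div_nthPrime_sub_one.trans_tendsto
    (tendsto_inv_atTop_zero.comp tendsto_log_nthPrime)
  simpa using h.add_const 1

lemma isBigO_nthPrime_div_sub_log :
    (fun n : ℕ ↦ (nthPrime n : ℝ) / n - log (nthPrime n)) =O[atTop] fun _ ↦ (1 : ℝ) := by
  have h1 := (tendsto_mul_log_div_nthPrime.inv₀ one_ne_zero).isBigO_one ℝ
  refine ((h1.mul isBigO_mul_log_div_nthPrime_sub_one.neg_left).mul
    (isBigO_refl (fun n ↦ log (nthPrime n)) atTop)).congr' ?_ ?_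
  all_goals
    filter_upwards [tendsto_log_nthPrime.eventually_gt_atTop 0,
      tendsto_natCast_nthPrime.eventually_gt_atTop 0, eventually_gt_atTop 0] with n h1 h2 h3
    have h3' : (0 : ℝ) < n := by exact_mod_cast h3
    field_simp
  ring

lemma tendsto_log_nthPrime_sub :
    Tendsto (fun n : ℕ ↦ log (nthPrime n) - log n - log (log (nthPrime n))) atTop (nhds 0) := by
  have h := (tendsto_mul_log_div_nthPrime.log one_ne_zero).neg
  rw [log_one, neg_zero] at h
  refine h.congr' ?_
  filter_upwards [tendsto_log_nthPrime.eventually_gt_atTop 0,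
    tendsto_natCast_nthPrime.eventually_gt_atTop 0, eventually_gt_atTop 0] with n h1 h2 h3
  have h3' : (0 : ℝ) < n := by exact_mod_cast h3
  rw [log_div (by positivity) h2.ne', log_mul h3'.ne' h1.ne']
  ring

lemma tendsto_log_div_log_nthPrime :
    Tendsto (fun n : ℕ ↦ log n / log (nthPrime n)) atTop (nhds 1) := by
  have h1 : Tendsto (fun n ↦ log (log (nthPrime n)) / log (nthPrime n)) atTop (nhds 0) :=
    isLittleO_log_id_atTop.tendsto_div_nhds_zero.comp tendsto_log_nthPrime
  have h2 := tendsto_log_nthPrime_sub.mul (tendsto_inv_atTop_zero.comp tendsto_log_nthPrime)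
  have h3 := ((tendsto_const_nhds (x := (1 : ℝ))).sub h1).sub h2
  simp only [mul_zero, sub_zero] at h3
  refine h3.congr' ?_
  filter_upwards [tendsto_log_nthPrime.eventually_gt_atTop 0] with n hn
  rw [Function.comp_apply]
  field_simp
  ring

lemma tendsto_log_log_nthPrime_sub :
    Tendsto (fun n : ℕ ↦ log (log (nthPrime n)) - log (log n)) atTop (nhds 0) := by
  have h := (tendsto_log_div_log_nthPrime.log one_ne_zero).neg
  rw [log_one, neg_zero] at h
  refine h.congr' ?_
  filter_upwards [tendsto_log_nthPrime.eventually_gt_atTop 0,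
    (tendsto_log_atTop.comp tendsto_natCast_atTop_atTop).eventually_gt_atTop 0] with n h1 h2
  rw [Function.comp_apply] at h2
  rw [log_div h2.ne' h1.ne', neg_sub]

lemma isBigO_log_nthPrime_sub :
    (fun n : ℕ ↦ log (nthPrime n) - log n - log (log n)) =O[atTop] fun _ ↦ (1 : ℝ) :=
  ((tendsto_log_nthPrime_sub.add tendsto_log_log_nthPrime_sub).isBigO_one ℝ).congr_left
    fun n ↦ by ring

/-- The expansion `p_n = n (log n + log log n + O(1))`. -/
lemma isBigO_nthPrime_div_sub :
    (fun n : ℕ ↦ (nthPrime n : ℝ) / n - log n - log (log n)) =O[atTop] fun _ ↦ (1 : ℝ) :=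
  (isBigO_nthPrime_div_sub_log.add isBigO_log_nthPrime_sub).congr_left fun n ↦ by ring

lemma isBigO_nthPrime_nthPrime_div_sub :
    (fun n : ℕ ↦ (nthPrime (nthPrime n) : ℝ) / nthPrime n - log n - 2 * log (log n))
      =O[atTop] fun _ ↦ (1 : ℝ) :=
  (((isBigO_nthPrime_div_sub.comp_tendsto tendsto_nthPrime).add isBigO_log_nthPrime_sub).add
    (tendsto_log_log_nthPrime_sub.isBigO_one ℝ)).congr_left
    fun n ↦ by simp only [Function.comp_apply]; ring

end NthPrime

/-- The `n`-th prime-indexed prime satisfies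
`p_{p_n} = n·(log n)² + 3·n·(log n)·(log log n) + O(n·log n)` as `n → ∞`. -/
theorem pip_asymptotic_bigO :
    (fun n : ℕ => (nthPrime (nthPrime n) : ℝ)
        - n * (Real.log n) ^ 2 - 3 * n * Real.log n * Real.log (Real.log n))
      =O[atTop] (fun n : ℕ => (n : ℝ) * Real.log n) := by
  have hlog : Tendsto (fun n : ℕ ↦ log (n : ℝ)) atTop atTop :=
    tendsto_log_atTop.comp tendsto_natCast_atTop_atTop
  have ha := isBigO_nthPrime_div_sub
  have hb := isBigO_nthPrime_nthPrime_div_sub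
  have h1 : (fun _ : ℕ ↦ (1 : ℝ)) =O[atTop] fun n : ℕ ↦ log (n : ℝ) :=
    (isLittleO_const_log_atTop.comp_tendsto tendsto_natCast_atTop_atTop).isBigO
  have hl := isBigO_refl (fun n : ℕ ↦ log (n : ℝ)) atTop
  have hll : (fun n : ℕ ↦ log (log (n : ℝ))) =O[atTop] fun n : ℕ ↦ log (n : ℝ) :=
    (isLittleO_log_id_atTop.comp_tendsto hlog).isBigO
  have hll2 : (fun n : ℕ ↦ log (log (n : ℝ)) ^ 2) =O[atTop] fun n : ℕ ↦ log (n : ℝ) :=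
    ((isLittleO_pow_log_id_atTop (n := 2)).comp_tendsto hlog).isBigO
  have hA := ha.mul (hl.add (hll.const_mul_left 2))
  have hB := hb.mul (hl.add hll)
  have hAB := (ha.mul hb).trans (h1.congr_left fun _ ↦ (mul_one 1).symm)
  simp only [one_mul] at hA hB
  refine ((isBigO_refl (fun n : ℕ ↦ (n : ℝ)) atTop).mul
    ((((hll2.const_mul_left 2).add hA).add hB).add hAB)).congr' ?_ .rfl
  filter_upwards [tendsto_natCast_nthPrime.eventually_gt_atTop 0, eventually_gt_atTop 0]
    with n hp hn
  have hn' : (0 : ℝ) < n := by exact_mod_cast hn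
  field_simp
  ring
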